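/- Let G be a finite group of exponent m and let Γ = SC(G, T₁₁, T₂₂, T₁₂, T₂₁) be a quasi-abelian semi-Cayley digraph with adjacency matrix A, and I₁, I₂, I₃, T, K, M as below. Then Γ is integral — i.e. every complex root of the characteristic polynomial of A is a rational integer — if and only if T = (ℤ/mℤ)ˣ and M is the trivial group. -/

import Mathlib

open IntermediateField

/-- A finset of elements of a group is conjugation-closed if its image under
conjugation by any group element equals itself. -/
def ConjClosedF {G : Type*} [Group G] [DecidableEq G] (T : Finset G) : Prop :=
  ∀ g : G, T.image (fun x => g⁻¹ * x * g) = T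

/-- The adjacency matrix (over ℚ, with 0/1 entries) of the semi-Cayley digraph
`SC(G, T₁₁, T₂₂, T₁₂, T₂₁)`. -/
def scMatrix {G : Type*} [Group G] [DecidableEq G] (T11 T22 T12 T21 : Finset G) :
    Matrix (G ⊕ G) (G ⊕ G) ℚ :=
  fun x y =>
    match x, y with
    | Sum.inl h, Sum.inl g => if g * h⁻¹ ∈ T11 then 1 else 0
    | Sum.inr h, Sum.inr g => if g * h⁻¹ ∈ T22 then 1 else 0
    | Sum.inl h, Sum.inr g => if g * h⁻¹ ∈ T12 then 1 else 0
    | Sum.inr h, Sum.inl g => if g * h⁻¹ ∈ T21 then 1 else 0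

/-- The multiset of pairwise products `[x·y : x ∈ X, y ∈ Y]` of two multisets of a group. -/
def msProd {G : Type*} [Group G] (X Y : Multiset G) : Multiset G :=
  X.bind (fun x => Y.map (fun y => x * y))

/-- The `t`-th power map on multisets of a group, for `t` a unit modulo the exponent. -/
def msPow {G : Type*} [Group G] {m : ℕ} (t : (ZMod m)ˣ) (X : Multiset G) : Multiset G :=
  X.map (fun x => x ^ ((t : ZMod m).val))

/-- `χ : G → ℂ` is an irreducible complex character of `G` if it is the trace function of
a nonzero irreducible finite-dimensional complex representation of `G`. -/
def IsIrrChar (G : Type*) [Group G] (χ : G → ℂ) : Prop :=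
  ∃ (V : Type) (_ : AddCommGroup V) (_ : Module ℂ V) (_ : FiniteDimensional ℂ V)
    (_ : Nontrivial V) (ρ : Representation ℂ G V),
    (∀ W : Submodule ℂ V, (∀ g : G, ∀ v ∈ W, ρ g v ∈ W) → W = ⊥ ∨ W = ⊤) ∧
    ∀ g : G, χ g = LinearMap.trace ℂ V (ρ g)

open MonoidAlgebra in
/-- The linear extension of a function on `G` to the group algebra. -/
noncomputable def charEval {G : Type*} [Fintype G] (χ : G → ℂ) : ℂ[G] →ₗ[ℂ] ℂ where
  toFun z := ∑ g, z.coeff g * χ g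
  map_add' x y := by simp [add_mul, Finset.sum_add_distrib]
  map_smul' c x := by simp [Finset.mul_sum, mul_assoc]

section CentralCharacters

open MonoidAlgebra

variable {G : Type*} [Group G] [Fintype G]

omit [Group G] in
theorem charEval_single (χ : G → ℂ) (g : G) (c : ℂ) :
    charEval χ (single g c) = c * χ g := by
  classical
  simp [charEval, Finsupp.single_apply]

theorem charEval_trace {V : Type*} [AddCommGroup V] [Module ℂ V] (ρ : Representation ℂ G V)
    (χ : G → ℂ) (hχ : ∀ g, χ g = LinearMap.trace ℂ V (ρ g)) (z : ℂ[G]) :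
    charEval χ z = LinearMap.trace ℂ V (ρ.asAlgebraHom z) := by
  induction z using MonoidAlgebra.induction_linear with
  | zero => simp
  | add x y hx hy => simp [hx, hy]
  | single g c => simp [charEval_single, hχ]

/-- A central element of the group algebra acts on some nonzero left ideal vector by the central
character attached to an irreducible character. -/
theorem IsIrrChar.exists_eigenvector {χ : G → ℂ} (hχ : IsIrrChar G χ) :
    ∃ d : ℕ, 0 < d ∧ χ 1 = d ∧ ∃ u : ℂ[G], u ≠ 0 ∧
      ∀ z : ℂ[G], (∀ y, Commute z y) → z * u = (charEval χ z / d) • u := by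
  obtain ⟨V, _, _, _, _, ρ, hirr, htr⟩ := hχ
  refine ⟨Module.finrank ℂ V, Module.finrank_pos, by simp [htr], ?_⟩
  obtain ⟨v, hv⟩ := exists_ne (0 : V)
  obtain ⟨φ, hφ⟩ : ∃ φ : Module.Dual ℂ V, φ v ≠ 0 := by
    by_contra! h
    exact hv ((Module.forall_dual_apply_eq_zero_iff ℂ v).1 h)
  let U : V → ℂ[G] := fun w => ofCoeff (Finsupp.equivFunOnFinite.symm fun h => φ (ρ h⁻¹ w))
  have hU : ∀ w h, (U w).coeff h = φ (ρ h⁻¹ w) := fun w h => by simp [U]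
  have hmul : ∀ z w, z * U w = U (ρ.asAlgebraHom z w) := by
    intro z w
    induction z using MonoidAlgebra.induction_linear with
    | zero => ext h; simp [hU]
    | add x y hx hy => ext h; simp [hU, add_mul, hx, hy]
    | single g c =>
      ext h
      simp [hU, MonoidAlgebra.coeff_single_mul_apply, ← Module.End.mul_apply, ← map_mul]
  refine ⟨U v, fun h => hφ ?_, fun z hz => ?_⟩
  · have := hU v 1
    simpa [h] using this.symm
  · obtain ⟨μ, hμ⟩ := Module.End.exists_eigenvalue (ρ.asAlgebraHom z)
    have htop : Module.End.eigenspace (ρ.asAlgebraHom z) μ = ⊤ := by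
      refine (hirr _ fun g w hw => ?_).resolve_left hμ
      rw [Module.End.mem_eigenspace_iff] at hw ⊢
      have := congrArg (fun x => ρ.asAlgebraHom x w) (hz (single g 1)).eq
      simp only [map_mul, Representation.asAlgebraHom_single_one, Module.End.mul_apply] at this
      rw [this, hw, map_smul]
    have hz' : ρ.asAlgebraHom z = μ • LinearMap.id := by
      ext w
      exact Module.End.mem_eigenspace_iff.1 (htop ▸ Submodule.mem_top : w ∈ _)
    have hd : (Module.finrank ℂ V : ℂ) ≠ 0 := by exact_mod_cast Module.finrank_pos.ne'
    rw [hmul, charEval_trace ρ χ htr, hz']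
    simp only [map_smul, LinearMap.trace_id, smul_eq_mul, mul_div_cancel_right₀ _ hd]
    ext h
    simp [hU]

/-- Every simple left ideal of the group algebra affords an irreducible character, through which
central elements act. -/
theorem exists_isIrrChar_of_isSimpleModule (S : Submodule ℂ[G] ℂ[G]) [IsSimpleModule ℂ[G] S] :
    ∃ χ : G → ℂ, IsIrrChar G χ ∧
      ∀ z : ℂ[G], charEval χ z = LinearMap.trace ℂ S (Algebra.lsmul ℂ ℂ S z) := by
  have : FiniteDimensional ℂ ℂ[G] := inferInstance
  have : FiniteDimensional ℂ S := inferInstanceAs (FiniteDimensional ℂ (S.restrictScalars ℂ))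
  have : Nontrivial S := IsSimpleModule.nontrivial ℂ[G] S
  let e : S ≃ₗ[ℂ] (Fin (Module.finrank ℂ S) → ℂ) := LinearEquiv.ofFinrankEq _ _ (by simp)
  let ρ : Representation ℂ G (Fin (Module.finrank ℂ S) → ℂ) :=
    ((e.conjAlgEquiv ℂ).toAlgHom.comp (Algebra.lsmul ℂ ℂ S)).toMonoidHom.comp (of ℂ G)
  have hρ : ∀ g x, ρ g x = e (single g (1 : ℂ) • e.symm x) := fun g x => rfl
  have htr : ∀ g, LinearMap.trace ℂ _ (ρ g) =
      LinearMap.trace ℂ S (Algebra.lsmul ℂ ℂ S (single g (1 : ℂ))) := fun g =>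
    LinearMap.trace_conj' _ e
  refine ⟨fun g => LinearMap.trace ℂ _ (ρ g), ⟨_, _, _, inferInstance, e.symm.toEquiv.nontrivial, ρ,
    fun W hW => ?_, fun _ => rfl⟩, fun z => ?_⟩
  · have hW' : ∀ (z : ℂ[G]) (s : S), e s ∈ W → e (z • s) ∈ W := by
      intro z s hs
      induction z using MonoidAlgebra.induction_linear with
      | zero => simp
      | add x y hx hy => rw [add_smul, map_add]; exact W.add_mem hx hy
      | single g c =>
        have h1 := hW g _ hs
        rw [hρ, e.symm_apply_apply] at h1
        have : single g c = c • single g (1 : ℂ) := by simp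
        rw [this, smul_assoc, map_smul]
        exact W.smul_mem _ h1
    let N : Submodule ℂ[G] S :=
      { carrier := {s | e s ∈ W}
        add_mem' := fun ha hb => by simpa using W.add_mem ha hb
        zero_mem' := by simp
        smul_mem' := hW' }
    have hN : ∀ x, x ∈ W ↔ e.symm x ∈ N := fun x => by simp [N]
    rcases eq_bot_or_eq_top N with h | h
    · left
      rw [eq_bot_iff]
      intro x hx
      rw [hN, h] at hx
      simpa using hx
    · right
      rw [eq_top_iff]
      intro x _
      rw [hN, h]
      trivial
  · induction z using MonoidAlgebra.induction_linear with
    | zero => simp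
    | add x y hx hy => simp [hx, hy]
    | single g c =>
      have : single g c = c • single g (1 : ℂ) := by simp
      rw [charEval_single, htr, this, map_smul, map_smul, smul_eq_mul]

theorem exists_charEval_eq_zero {D u : ℂ[G]} (hD : ∀ y, Commute D y) (hu : u ≠ 0)
    (h : D * u = 0) : ∃ χ : G → ℂ, IsIrrChar G χ ∧ charEval χ D = 0 := by
  let N : Submodule ℂ[G] ℂ[G] :=
    { carrier := {x | D * x = 0}
      add_mem' := fun {a b} ha hb => by
        have ha : D * a = 0 := ha
        have hb : D * b = 0 := hb
        simp [mul_add, ha, hb]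
      zero_mem' := by simp
      smul_mem' := fun c x hx => by
        have hx : D * x = 0 := hx
        simp [← mul_assoc, (hD c).eq]
        simp [mul_assoc, hx] }
  have hN : N ≠ ⊥ := fun hb => hu <| by
    have : u ∈ N := h
    rwa [hb] at this
  obtain ⟨S, hSN, hS⟩ := (IsSemisimpleModule.eq_bot_or_exists_simple_le N).resolve_left hN
  obtain ⟨χ, hχ, hz⟩ := exists_isIrrChar_of_isSimpleModule S
  refine ⟨χ, hχ, ?_⟩
  have : Algebra.lsmul ℂ ℂ S D = 0 := by
    ext s
    have : D * (s : ℂ[G]) = 0 := hSN s.2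
    simp [this]
  rw [hz, this, map_zero]

theorem eq_zero_of_charEval_eq_zero {D : ℂ[G]} (hD : ∀ y, Commute D y)
    (h : ∀ χ : G → ℂ, IsIrrChar G χ → charEval χ D = 0) : D = 0 := by
  let L : ℂ[G] →ₗ[ℂ[G]] ℂ[G] :=
    { toFun := fun x => D * x
      map_add' := mul_add D
      map_smul' := fun c x => by simp [← mul_assoc, (hD c).eq] }
  suffices LinearMap.ker L = ⊤ by
    have : (1 : ℂ[G]) ∈ LinearMap.ker L := this ▸ Submodule.mem_top
    simpa [L] using this
  rw [eq_top_iff, ← IsSemisimpleModule.sSup_simples_eq_top]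
  refine sSup_le fun S (hS : IsSimpleModule _ S) => ?_
  obtain ⟨χ, hχ, hz⟩ := exists_isIrrChar_of_isSimpleModule S
  have : FiniteDimensional ℂ S := inferInstanceAs (FiniteDimensional ℂ (S.restrictScalars ℂ))
  have : Nontrivial S := IsSimpleModule.nontrivial ℂ[G] S
  have hLS : ∀ s ∈ S, L s ∈ S := fun s hs => S.smul_mem D hs
  obtain ⟨μ, hμ⟩ :=
    (IsSimpleModule.algebraMap_end_bijective_of_isAlgClosed (A := ℂ[G]) (V := S) ℂ).2
      (L.restrict hLS)
  have hs : ∀ s : S, D • s = μ • s := fun s =>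
    (LinearMap.congr_fun hμ s).symm
  have h0 : charEval χ D = μ * Module.finrank ℂ S := by
    rw [hz, show Algebra.lsmul ℂ ℂ S D = μ • LinearMap.id from LinearMap.ext hs]
    simp
  rw [h χ hχ, eq_comm, mul_eq_zero] at h0
  have hμ0 : μ = 0 := h0.resolve_right (by exact_mod_cast Module.finrank_pos.ne')
  intro s hsS
  have := congrArg Subtype.val (hs ⟨s, hsS⟩)
  simpa [hμ0, L] using this

omit [Fintype G] in
theorem commute_of_coeff_conj {z : ℂ[G]} (hz : ∀ g h : G, z.coeff (h⁻¹ * g * h) = z.coeff g)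
    (y : ℂ[G]) : Commute z y := by
  induction y using MonoidAlgebra.induction_linear with
  | zero => exact Commute.zero_right z
  | add x y hx hy => exact hx.add_right hy
  | single h c =>
    ext g
    rw [coeff_mul_single_apply, coeff_single_mul_apply, ← hz (g * h⁻¹) h, mul_comm c]
    simp [mul_assoc]

theorem IsIrrChar.charEval_mul {χ : G → ℂ} (hχ : IsIrrChar G χ) {x y : ℂ[G]}
    (hx : ∀ w, Commute x w) (hy : ∀ w, Commute y w) :
    charEval χ (x * y) / χ 1 = (charEval χ x / χ 1) * (charEval χ y / χ 1) := by
  obtain ⟨d, hd, h1, u, hu, hz⟩ := hχ.exists_eigenvector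
  rw [h1]
  have h := hz (x * y) fun w => (hx w).mul_left (hy w)
  rw [mul_assoc, hz y hy, mul_smul_comm, hz x hx, smul_smul] at h
  rw [← smul_left_injective ℂ hu h, mul_comm]

/-- The group algebra element summing the members of a multiset. -/
noncomputable def multisetSum {G : Type*} (X : Multiset G) : ℂ[G] :=
  (X.map fun x => single x (1 : ℂ)).sum

omit [Fintype G] in
theorem multisetSum_add (X Y : Multiset G) :
    multisetSum (X + Y) = multisetSum X + multisetSum Y := by
  simp [multisetSum]

omit [Fintype G] in
theorem multisetSum_nsmul (n : ℕ) (X : Multiset G) :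
    multisetSum (n • X) = n • multisetSum X := by
  simp [multisetSum, Multiset.map_nsmul, Multiset.sum_nsmul]

omit [Fintype G] in
theorem multisetSum_msProd (X Y : Multiset G) :
    multisetSum (msProd X Y) = multisetSum X * multisetSum Y := by
  simp only [multisetSum, msProd, Multiset.map_bind, Multiset.map_map, Multiset.sum_bind,
    Function.comp_def]
  rw [← Multiset.sum_map_mul_right]
  refine congrArg Multiset.sum (Multiset.map_congr rfl fun x _ => ?_)
  rw [← Multiset.sum_map_mul_left]
  simp [single_mul_single]

omit [Fintype G] in
theorem coeff_multisetSum [DecidableEq G] (X : Multiset G) (g : G) :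
    (multisetSum X).coeff g = X.count g := by
  induction X using Multiset.induction_on with
  | empty => simp [multisetSum]
  | cons a X ih =>
    have : multisetSum (a ::ₘ X) = single a (1 : ℂ) + multisetSum X := by simp [multisetSum]
    rw [this, coeff_add, Finsupp.add_apply, ih, Multiset.count_cons, coeff_single,
      Finsupp.single_apply]
    rcases eq_or_ne g a with rfl | h
    · simp [add_comm]
    · simp [h, h.symm]

omit [Group G] in
theorem charEval_multisetSum (χ : G → ℂ) (X : Multiset G) :
    charEval χ (multisetSum X) = (X.map χ).sum := by
  simp [multisetSum, map_multiset_sum, Multiset.map_map, charEval_single]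

omit [Fintype G] in
theorem ConjClosedF.mem_iff [DecidableEq G] {T : Finset G} (hT : ConjClosedF T) (g h : G) :
    h⁻¹ * g * h ∈ T ↔ g ∈ T := by
  constructor
  · intro hg
    have := Finset.mem_image_of_mem (fun x => h⁻¹⁻¹ * x * h⁻¹) hg
    rw [hT] at this
    simpa [mul_assoc] using this
  · intro hg
    have := Finset.mem_image_of_mem (fun x => h⁻¹ * x * h) hg
    rwa [hT] at this

omit [Fintype G] in
theorem ConjClosedF.commute [DecidableEq G] {T : Finset G} (hT : ConjClosedF T) (y : ℂ[G]) :
    Commute (multisetSum T.val) y := by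
  refine commute_of_coeff_conj (fun g h => ?_) y
  simp [coeff_multisetSum, Multiset.count_eq_of_nodup T.nodup, hT.mem_iff]

section Spectrum

variable [DecidableEq G] (T11 T22 T12 T21 : Finset G)

omit [Fintype G] [DecidableEq G] in
theorem coeff_mul_multisetSum (u : ℂ[G]) (T : Finset G) (k : G) :
    (u * multisetSum T.val).coeff k = ∑ x ∈ T, u.coeff (k * x⁻¹) := by
  change (u * ∑ x ∈ T, single x (1 : ℂ)).coeff k = _
  rw [Finset.mul_sum, coeff_sum, Finsupp.finsetSum_apply]
  simp [coeff_mul_single_apply]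

theorem sum_ite_mul_inv_mem (T : Finset G) (u : G → ℂ) (h : G) :
    ∑ g, (if g * h⁻¹ ∈ T then 1 else 0) * u g = ∑ x ∈ T, u (x * h) := by
  rw [← Equiv.sum_comp (Equiv.mulRight h)]
  simp

/-- The eigenvalue equation of the adjacency matrix in terms of the group algebra. -/
theorem aeval_charpoly_scMatrix_eq_zero_iff (z : ℂ) :
    Polynomial.aeval z (scMatrix T11 T22 T12 T21).charpoly = 0 ↔
      ∃ U V : ℂ[G], (U ≠ 0 ∨ V ≠ 0) ∧
        U * multisetSum T11.val + V * multisetSum T12.val = z • U ∧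
        U * multisetSum T21.val + V * multisetSum T22.val = z • V := by
  have key : Polynomial.aeval z (scMatrix T11 T22 T12 T21).charpoly = 0 ↔
      ∃ w : G ⊕ G → ℂ, w ≠ 0 ∧
        ((scMatrix T11 T22 T12 T21).map (algebraMap ℚ ℂ)).mulVec w = z • w := by
    rw [Polynomial.aeval_def, ← Polynomial.eval_map, ← Matrix.charpoly_map, Matrix.eval_charpoly,
      ← Matrix.exists_mulVec_eq_zero_iff]
    simp only [Matrix.sub_mulVec, sub_eq_zero]
    refine exists_congr fun w => and_congr_right fun _ => ?_
    rw [eq_comm]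
    simp [← Matrix.smul_one_eq_diagonal, Matrix.smul_mulVec]
  let E : (G → ℂ) ≃ ℂ[G] :=
    ((Equiv.inv G).arrowCongr (Equiv.refl ℂ)).trans
      (Finsupp.equivFunOnFinite.symm.trans coeffEquiv.symm)
  have hE : ∀ u k, (E u).coeff k = u k⁻¹ := fun u k => rfl
  have hE0 : ∀ u, E u = 0 ↔ u = 0 := by
    intro u
    constructor
    · intro h
      ext g
      have := hE u g⁻¹
      simpa [h] using this.symm
    · rintro rfl
      ext g
      simp [hE]
  rw [key]
  have hrow : ∀ (u v : G → ℂ) (S S' : Finset G) (w : G → ℂ),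
      (E u * multisetSum S.val + E v * multisetSum S'.val = z • E w) ↔
      ∀ h, ∑ x ∈ S, u (x * h) + ∑ x ∈ S', v (x * h) = z * w h := by
    intro u v S S' w
    constructor
    · intro h k
      have := congrArg (fun x => x.coeff k⁻¹) h
      simpa [coeff_mul_multisetSum, hE] using this
    · intro h
      ext k
      simpa [coeff_mul_multisetSum, hE] using h k⁻¹
  constructor
  · rintro ⟨w, hw, h⟩
    refine ⟨E (fun g => w (Sum.inl g)), E (fun g => w (Sum.inr g)), ?_, ?_, ?_⟩
    · by_contra! h0
      rw [hE0, hE0] at h0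
      refine hw (funext ?_)
      rintro (g | g)
      · exact congrFun h0.1 g
      · exact congrFun h0.2 g
    · rw [hrow]
      intro g
      have := congrFun h (Sum.inl g)
      simpa [Matrix.mulVec, dotProduct, scMatrix, apply_ite, sum_ite_mul_inv_mem,
        -ite_mul] using this
    · rw [hrow]
      intro g
      have := congrFun h (Sum.inr g)
      simpa [Matrix.mulVec, dotProduct, scMatrix, apply_ite, sum_ite_mul_inv_mem,
        -ite_mul] using this
  · rintro ⟨U, V, hUV, h1, h2⟩
    obtain ⟨u, rfl⟩ := E.surjective U
    obtain ⟨v, rfl⟩ := E.surjective V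
    rw [hrow] at h1 h2
    refine ⟨Sum.elim u v, ?_, ?_⟩
    · intro h0
      rw [Ne, Ne, hE0, hE0, ← not_and_or] at hUV
      exact hUV ⟨funext fun g => congrFun h0 (Sum.inl g), funext fun g => congrFun h0 (Sum.inr g)⟩
    · funext g
      rcases g with g | g
      · simpa [Matrix.mulVec, dotProduct, scMatrix, apply_ite, sum_ite_mul_inv_mem,
          -ite_mul] using h1 g
      · simpa [Matrix.mulVec, dotProduct, scMatrix, apply_ite, sum_ite_mul_inv_mem,
          -ite_mul] using h2 g

theorem exists_ne_zero_of_charpoly_two {a b c e z : ℂ} (h : (z - a) * (z - e) = b * c) :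
    ∃ p q : ℂ, (p ≠ 0 ∨ q ≠ 0) ∧ p * a + q * b = z * p ∧ p * c + q * e = z * q := by
  by_cases hb : b = 0
  · by_cases hc : c = 0
    · rw [hb, zero_mul, mul_eq_zero, sub_eq_zero, sub_eq_zero] at h
      rcases h with rfl | rfl
      · exact ⟨1, 0, by simp [hb, hc]⟩
      · exact ⟨0, 1, by simp [hb, hc]⟩
    · exact ⟨z - e, c, .inr hc, by linear_combination -h, by ring⟩
  · exact ⟨b, z - a, .inl hb, by ring, by linear_combination -h⟩

/-- The spectrum of a quasi-abelian semi-Cayley digraph: each irreducible character contributes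
the roots of a quadratic. -/
theorem aeval_charpoly_scMatrix_eq_zero_iff_exists_isIrrChar
    (h11 : ConjClosedF T11) (h22 : ConjClosedF T22)
    (h12 : ConjClosedF T12) (h21 : ConjClosedF T21) (z : ℂ) :
    Polynomial.aeval z (scMatrix T11 T22 T12 T21).charpoly = 0 ↔
      ∃ χ : G → ℂ, IsIrrChar G χ ∧
        (z - (T11.val.map χ).sum / χ 1) * (z - (T22.val.map χ).sum / χ 1) =
          ((T12.val.map χ).sum / χ 1) * ((T21.val.map χ).sum / χ 1) := by
  rw [aeval_charpoly_scMatrix_eq_zero_iff]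
  simp_rw [← charEval_multisetSum]
  have c11 := h11.commute
  have c22 := h22.commute
  have c12 := h12.commute
  have c21 := h21.commute
  generalize multisetSum T11.val = t11 at *
  generalize multisetSum T22.val = t22 at *
  generalize multisetSum T12.val = t12 at *
  generalize multisetSum T21.val = t21 at *
  constructor
  · rintro ⟨U, V, hUV, hU, hV⟩
    have cz : ∀ y, Commute (z • (1 : ℂ[G])) y := fun y => (Commute.one_left y).smul_left z
    have ca : ∀ y, Commute (z • 1 - t11) y := fun y => (cz y).sub_left (c11 y)
    have ce : ∀ y, Commute (z • 1 - t22) y := fun y => (cz y).sub_left (c22 y)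
    have cD : ∀ y, Commute ((z • 1 - t11) * (z • 1 - t22) - t12 * t21) y := fun y =>
      ((ca y).mul_left (ce y)).sub_left ((c12 y).mul_left (c21 y))
    have e1 : U * (z • 1 - t11) = V * t12 := by
      rw [mul_sub, mul_smul_comm, mul_one, ← hU]; abel
    have e2 : V * (z • 1 - t22) = U * t21 := by
      rw [mul_sub, mul_smul_comm, mul_one, ← hV]; abel
    obtain ⟨χ, hχ, h0⟩ : ∃ χ : G → ℂ, IsIrrChar G χ ∧
        charEval χ ((z • 1 - t11) * (z • 1 - t22) - t12 * t21) = 0 := by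
      rcases hUV with h | h
      · refine exists_charEval_eq_zero cD h ?_
        rw [(cD U).eq, mul_sub, ← mul_assoc, e1, mul_assoc, ← (ce t12).eq, ← mul_assoc, e2,
          mul_assoc, (c21 t12).eq, sub_self]
      · refine exists_charEval_eq_zero cD h ?_
        rw [(cD V).eq, mul_sub, (ca _).eq, ← mul_assoc, e2, mul_assoc, ← (ca t21).eq, ← mul_assoc,
          e1, mul_assoc, sub_self]
    refine ⟨χ, hχ, ?_⟩
    obtain ⟨d, hd, h1, -⟩ := hχ.exists_eigenvector
    have hd' : χ 1 ≠ 0 := by rw [h1]; exact_mod_cast hd.ne'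
    have hone : charEval χ (1 : ℂ[G]) = χ 1 := by simp [one_def, charEval_single]
    have hsub : ∀ t, charEval χ (z • 1 - t) / χ 1 = z - charEval χ t / χ 1 := by
      intro t
      rw [map_sub, map_smul, hone, smul_eq_mul, sub_div, mul_div_cancel_right₀ _ hd']
    rw [map_sub, sub_eq_zero] at h0
    rw [← hsub, ← hsub, ← hχ.charEval_mul ca ce, ← hχ.charEval_mul c12 c21, h0]
  · rintro ⟨χ, hχ, h⟩
    obtain ⟨d, hd, h1, u, hu, hz⟩ := hχ.exists_eigenvector
    rw [h1] at h
    obtain ⟨p, q, hpq, hp, hq⟩ := exists_ne_zero_of_charpoly_two h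
    refine ⟨p • u, q • u, by simpa [hu] using hpq, ?_, ?_⟩
    · rw [smul_mul_assoc, smul_mul_assoc, ← (c11 u).eq, ← (c12 u).eq, hz _ c11, hz _ c12,
        smul_smul, smul_smul, smul_smul, ← add_smul, hp]
    · rw [smul_mul_assoc, smul_mul_assoc, ← (c21 u).eq, ← (c22 u).eq, hz _ c21, hz _ c22,
        smul_smul, smul_smul, smul_smul, ← add_smul, hq]

end Spectrum

end CentralCharacters

section CyclotomicValues

open MonoidAlgebra

theorem Module.End.exists_trace_pow_eq_sum {V : Type*} [AddCommGroup V] [Module ℂ V]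
    [FiniteDimensional ℂ V] (f : Module.End ℂ V) {m : ℕ} (hm : m ≠ 0) (hf : f ^ m = 1) :
    ∃ (s : Finset ℂ) (n : ℂ → ℕ), (∀ μ ∈ s, μ ^ m = 1) ∧
      ∀ k : ℕ, LinearMap.trace ℂ V (f ^ k) = ∑ μ ∈ s, n μ * μ ^ k := by
  classical
  have hss : f.IsSemisimple := by
    refine Module.End.isSemisimple_of_squarefree_aeval_eq_zero
      (p := Polynomial.X ^ m - 1) ?_ (by simp [hf])
    exact (Polynomial.separable_X_pow_sub_C 1 (by exact_mod_cast hm) one_ne_zero).squarefree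
  have hint : DirectSum.IsInternal f.eigenspace :=
    DirectSum.isInternal_submodule_of_iSupIndep_of_iSup_eq_top f.eigenspaces_iSupIndep
      hss.iSup_eigenspace_eq_top
  have hfin : {μ | f.eigenspace μ ≠ ⊥}.Finite :=
    WellFoundedGT.finite_ne_bot_of_iSupIndep f.eigenspaces_iSupIndep
  have hpow : ∀ (k : ℕ) (μ : ℂ), ∀ v ∈ f.eigenspace μ, (f ^ k) v = μ ^ k • v := by
    intro k μ v hv
    rw [Module.End.mem_eigenspace_iff] at hv
    induction k with
    | zero => simp
    | succ k ih => rw [pow_succ', Module.End.mul_apply, ih, map_smul, hv, smul_smul, pow_succ]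
  refine ⟨hfin.toFinset, fun μ => Module.finrank ℂ (f.eigenspace μ), fun μ hμ => ?_, fun k => ?_⟩
  · obtain ⟨v, hv, hv0⟩ := Submodule.exists_mem_ne_zero_of_ne_bot (hfin.mem_toFinset.1 hμ)
    have := hpow m μ v hv
    rw [hf, Module.End.one_apply] at this
    exact (smul_left_injective ℂ hv0 (by simpa using this)).symm
  · have hmaps : ∀ μ, Set.MapsTo (f ^ k) (f.eigenspace μ) (f.eigenspace μ) := by
      intro μ v hv
      rw [SetLike.mem_coe] at hv ⊢
      rw [hpow k μ v hv]
      exact Submodule.smul_mem _ _ hv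
    rw [LinearMap.trace_eq_sum_trace_restrict' hint hfin hmaps]
    refine Finset.sum_congr rfl fun μ _ => ?_
    have : (f ^ k).restrict (hmaps μ) = μ ^ k • LinearMap.id := by
      ext v
      exact hpow k μ v v.2
    rw [this, map_smul, LinearMap.trace_id, smul_eq_mul, mul_comm]

variable {G : Type*} [Group G] [Fintype G]

instance : NeZero (Monoid.exponent G) := ⟨Monoid.exponent_ne_zero_of_finite⟩

/-- Irreducible characters take values in the cyclotomic field of the exponent, and the Galois
action corresponds to taking powers of group elements. -/
theorem IsIrrChar.exists_cyclotomic {L : Type*} [Field L] [Algebra ℚ L] (i : L →ₐ[ℚ] ℂ) {ζ : L}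
    (hζ : IsPrimitiveRoot ζ (Monoid.exponent G)) {χ : G → ℂ} (hχ : IsIrrChar G χ) :
    ∃ ψ : G → L, (∀ g, i (ψ g) = χ g) ∧
      ∀ (σ : L ≃ₐ[ℚ] L) (t : ℕ), σ ζ = ζ ^ t → ∀ g, σ (ψ g) = ψ (g ^ t) := by
  obtain ⟨V, _, _, _, _, ρ, -, htr⟩ := hχ
  have h : ∀ g : G, ∃ (s : Finset ℂ) (n : ℂ → ℕ), (∀ μ ∈ s, μ ^ Monoid.exponent G = 1) ∧
      ∀ k : ℕ, χ (g ^ k) = ∑ μ ∈ s, n μ * μ ^ k := by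
    intro g
    simp_rw [htr, map_pow]
    exact Module.End.exists_trace_pow_eq_sum (ρ g) NeZero.out
      (by rw [← map_pow, Monoid.pow_exponent_eq_one, map_one])
  choose s n hs hχ using h
  have hi : IsPrimitiveRoot (i ζ) (Monoid.exponent G) := hζ.map_of_injective i.injective
  have h : ∀ μ : ℂ, ∃ j : ℕ, μ ^ Monoid.exponent G = 1 → i ζ ^ j = μ := by
    intro μ
    by_cases hμ : μ ^ Monoid.exponent G = 1
    · obtain ⟨j, -, hj⟩ := hi.eq_pow_of_pow_eq_one hμ
      exact ⟨j, fun _ => hj⟩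
    · exact ⟨0, fun h => absurd h hμ⟩
  choose j hj using h
  have hψ : ∀ g, i (∑ μ ∈ s g, n g μ * ζ ^ j μ) = χ g := by
    intro g
    conv_rhs => rw [← pow_one g, hχ]
    simp only [map_sum, map_mul, map_natCast, map_pow, pow_one]
    exact Finset.sum_congr rfl fun μ hμ => by rw [hj μ (hs g μ hμ)]
  refine ⟨fun g => ∑ μ ∈ s g, n g μ * ζ ^ j μ, hψ, fun σ t ht g => i.injective ?_⟩
  change i (σ (∑ μ ∈ s g, n g μ * ζ ^ j μ)) = i (∑ μ ∈ s (g ^ t), n (g ^ t) μ * ζ ^ j μ)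
  rw [hψ, hχ]
  simp only [map_sum, map_mul, map_natCast, map_pow, ht]
  exact Finset.sum_congr rfl fun μ hμ => by rw [pow_right_comm, hj μ (hs g μ hμ)]

theorem pow_val_pow_val_inv (t : (ZMod (Monoid.exponent G))ˣ) (g : G) :
    (g ^ (t : ZMod (Monoid.exponent G)).val) ^ ((t⁻¹ : (ZMod (Monoid.exponent G))ˣ) :
      ZMod (Monoid.exponent G)).val = g := by
  rw [← pow_mul]
  conv_rhs => rw [← pow_one g]
  refine pow_eq_pow_iff_modEq.2 (Nat.ModEq.of_dvd (Monoid.order_dvd_exponent g) ?_)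
  rw [← ZMod.natCast_eq_natCast_iff]
  simp

/-- The power map by a unit modulo the exponent, as a permutation of the group. -/
noncomputable def unitPowEquiv (t : (ZMod (Monoid.exponent G))ˣ) : G ≃ G where
  toFun g := g ^ (t : ZMod (Monoid.exponent G)).val
  invFun g := g ^ ((t⁻¹ : (ZMod (Monoid.exponent G))ˣ) : ZMod (Monoid.exponent G)).val
  left_inv := pow_val_pow_val_inv t
  right_inv g := by simpa using pow_val_pow_val_inv t⁻¹ g

/-- An integral class function pairs rationally with all irreducible characters if and only if it
is invariant under the power maps by units modulo the exponent. -/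
theorem forall_isIrrChar_rat_iff (c : G → ℤ) (hc : ∀ g h : G, c (h⁻¹ * g * h) = c g) :
    (∀ χ : G → ℂ, IsIrrChar G χ → ∃ q : ℚ, ∑ g, (c g : ℂ) * χ g = q) ↔
      ∀ (t : (ZMod (Monoid.exponent G))ˣ) (g : G),
        c (g ^ (t : ZMod (Monoid.exponent G)).val) = c g := by
  obtain ⟨L, _, _, _⟩ : ∃ (L : Type) (_ : Field L) (_ : Algebra ℚ L),
      IsCyclotomicExtension {Monoid.exponent G} ℚ L :=
    ⟨CyclotomicField (Monoid.exponent G) ℚ, inferInstance,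
      CyclotomicField.algebra _ ℚ, CyclotomicField.isCyclotomicExtension _ ℚ⟩
  have : FiniteDimensional ℚ L :=
    IsCyclotomicExtension.finiteDimensional {Monoid.exponent G} ℚ L
  have : IsGalois ℚ L := IsCyclotomicExtension.isGalois {Monoid.exponent G} ℚ L
  let i : L →ₐ[ℚ] ℂ := IsAlgClosed.lift
  have hζ := IsCyclotomicExtension.zeta_spec (Monoid.exponent G) ℚ L
  have hirr := Polynomial.cyclotomic.irreducible_rat (NeZero.pos (Monoid.exponent G))
  constructor
  · intro h t
    let D : ℂ[G] := ofCoeff (Finsupp.equivFunOnFinite.symm fun g =>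
      ((c (g ^ (t : ZMod (Monoid.exponent G)).val) - c g : ℤ) : ℂ))
    have hD : ∀ g, D.coeff g = ((c (g ^ (t : ZMod (Monoid.exponent G)).val) - c g : ℤ) : ℂ) :=
      fun g => rfl
    suffices D = 0 by
      intro g
      have h0 := hD g
      rw [this, coeff_zero, Finsupp.zero_apply, eq_comm, Int.cast_eq_zero] at h0
      exact sub_eq_zero.1 h0
    refine eq_zero_of_charEval_eq_zero (commute_of_coeff_conj fun g k => ?_) fun χ hχ => ?_
    · have : (k⁻¹ * g * k) ^ (t : ZMod (Monoid.exponent G)).val =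
          k⁻¹ * g ^ (t : ZMod (Monoid.exponent G)).val * k := by
        simpa using conj_pow (a := k⁻¹) (b := g)
      rw [hD, hD, this, hc, hc]
    · obtain ⟨ψ, hψ, hσ⟩ := hχ.exists_cyclotomic i hζ
      obtain ⟨q, hq⟩ := h χ hχ
      let σ := (IsCyclotomicExtension.autEquivPow L hirr).symm t⁻¹
      have hσζ : σ (IsCyclotomicExtension.zeta (Monoid.exponent G) ℚ L) = _ ^ _ :=
        (hζ.autToPow_spec ℚ σ).symm
      have hσt : hζ.autToPow ℚ σ = t⁻¹ :=
        (IsCyclotomicExtension.autEquivPow L hirr).apply_symm_apply t⁻¹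
      rw [hσt] at hσζ
      have hL : ∑ g, (c g : L) * ψ g = algebraMap ℚ L q := by
        apply i.injective
        simpa [hψ] using hq
      have hL' := congrArg σ hL
      simp only [map_sum, map_mul, map_intCast, AlgEquiv.commutes, hσ σ _ hσζ] at hL'
      rw [← (unitPowEquiv t).sum_comp] at hL'
      have e : ∀ g, unitPowEquiv t g = g ^ (t : ZMod (Monoid.exponent G)).val := fun g => rfl
      simp only [e, pow_val_pow_val_inv] at hL'
      have hC := congrArg i (hL'.trans hL.symm)
      simp only [map_sum, map_mul, map_intCast, hψ] at hC
      change ∑ g, D.coeff g * χ g = 0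
      simp only [hD, Int.cast_sub, sub_mul, Finset.sum_sub_distrib, hC, sub_self]
  · intro h χ hχ
    obtain ⟨ψ, hψ, hσ⟩ := hχ.exists_cyclotomic i hζ
    have hfix : ∑ g, (c g : L) * ψ g ∈ Set.range (algebraMap ℚ L) := by
      refine (IsGalois.mem_range_algebraMap_iff_fixed _).2 fun σ => ?_
      simp only [map_sum, map_mul, map_intCast, hσ σ _ (hζ.autToPow_spec ℚ σ).symm]
      refine Fintype.sum_equiv (unitPowEquiv (hζ.autToPow ℚ σ)) _ _ fun g => ?_
      rw [← h (hζ.autToPow ℚ σ) g]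
      rfl
    obtain ⟨q, hq⟩ := hfix
    refine ⟨q, ?_⟩
    have := congrArg i hq
    simp only [map_sum, map_mul, map_intCast, hψ, AlgHom.commutes] at this
    simpa using this.symm

end CyclotomicValues

section SemiCayley

open MonoidAlgebra

variable {G : Type*} [Group G] [Fintype G] [DecidableEq G]

omit [Group G] [Fintype G] in
theorem sum_map_sub_sub_sum_map_sub (X Y : Multiset G) (χ : G → ℂ) :
    ((X - Y).map χ).sum - ((Y - X).map χ).sum = (X.map χ).sum - (Y.map χ).sum := by
  have h : X - Y + Y = Y - X + X := by
    ext g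
    simp only [Multiset.count_add, Multiset.count_sub]
    omega
  have := congrArg (fun Z => (Multiset.map χ Z).sum) h
  simp only [Multiset.map_add, Multiset.sum_add] at this
  linear_combination this

theorem sum_map_eq_sum_count (X : Multiset G) (χ : G → ℂ) :
    (X.map χ).sum = ∑ g, ((X.count g : ℤ) : ℂ) * χ g := by
  rw [← charEval_multisetSum]
  simp [charEval, coeff_multisetSum]

theorem msPow_eq_self_iff (t : (ZMod (Monoid.exponent G))ˣ) (X : Multiset G) :
    msPow t X = X ↔ ∀ g, X.count (g ^ (t : ZMod (Monoid.exponent G)).val) = X.count g := by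
  have h : ∀ g, (msPow t X).count (g ^ (t : ZMod (Monoid.exponent G)).val) = X.count g :=
    fun g => Multiset.count_map_eq_count' _ X (unitPowEquiv t).injective g
  constructor
  · intro hX g
    rw [← h g, hX]
  · intro hX
    ext g
    obtain ⟨k, rfl⟩ := (unitPowEquiv t).surjective g
    exact (h k).trans (hX k).symm

omit [Fintype G] in
theorem count_conj_of_commute {X : Multiset G} (hX : ∀ y, Commute (multisetSum X) y) (g h : G) :
    X.count (h⁻¹ * g * h) = X.count g := by
  have := congrArg (fun z => z.coeff (g * h)) (hX (single h 1)).eq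
  simp only [coeff_mul_single_apply, coeff_single_mul_apply, coeff_multisetSum] at this
  simpa [mul_assoc] using this.symm

theorem IsIrrChar.sum_msProd {χ : G → ℂ} (hχ : IsIrrChar G χ) {X Y : Finset G}
    (hX : ConjClosedF X) (hY : ConjClosedF Y) :
    χ 1 * ((msProd X.val Y.val).map χ).sum = (X.val.map χ).sum * (Y.val.map χ).sum := by
  obtain ⟨d, hd, h1, -⟩ := hχ.exists_eigenvector
  have hd' : χ 1 ≠ 0 := by rw [h1]; exact_mod_cast hd.ne'
  have := hχ.charEval_mul hX.commute hY.commute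
  rw [← multisetSum_msProd] at this
  simp only [charEval_multisetSum] at this
  field_simp at this
  linear_combination this

omit [Fintype G] in
theorem ConjClosedF.commute_msProd {X Y : Finset G}
    (hX : ConjClosedF X) (hY : ConjClosedF Y) (y : ℂ[G]) :
    Commute (multisetSum (msProd X.val Y.val)) y := by
  rw [multisetSum_msProd]
  exact (hX.commute y).mul_left (hY.commute y)

theorem isIntegral_of_aeval_charpoly_scMatrix {T11 T22 T12 T21 : Finset G} {z : ℂ}
    (hz : Polynomial.aeval z (scMatrix T11 T22 T12 T21).charpoly = 0) : IsIntegral ℤ z := by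
  let N : Matrix (G ⊕ G) (G ⊕ G) ℤ := fun x y => ⌊scMatrix T11 T22 T12 T21 x y⌋
  have hN : scMatrix T11 T22 T12 T21 = N.map (algebraMap ℤ ℚ) := by
    ext x y
    change scMatrix T11 T22 T12 T21 x y = (⌊scMatrix T11 T22 T12 T21 x y⌋ : ℚ)
    rcases x with x | x <;> rcases y with y | y <;>
      · simp only [scMatrix]
        split_ifs <;> simp
  refine ⟨N.charpoly, N.charpoly_monic, ?_⟩
  rwa [hN, Matrix.charpoly_map, Polynomial.aeval_map_algebraMap] at hz

theorem exists_int_of_isIntegral_of_rat {z : ℂ} (hz : IsIntegral ℤ z) {q : ℚ} (hq : z = q) :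
    ∃ n : ℤ, z = n := by
  have : IsIntegral ℤ q := by
    rw [hq] at hz
    exact (isIntegral_algebraMap_iff (algebraMap ℚ ℂ).injective).1 (by simpa using hz)
  obtain ⟨n, hn⟩ := IsIntegrallyClosed.isIntegral_iff.1 this
  exact ⟨n, by rw [hq, ← hn]; simp⟩

end SemiCayley

theorem stmt_17 {G : Type*} [Group G] [Fintype G] [DecidableEq G]
    (T11 T22 T12 T21 : Finset G)
    (h11 : ConjClosedF T11) (h22 : ConjClosedF T22)
    (h12 : ConjClosedF T12) (h21 : ConjClosedF T21)
    (I1 I2 I3 : Multiset G)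
    (hI1 : I1 = T11.val + T22.val)
    (hI2 : I2 = msProd T11.val T11.val + msProd T22.val T22.val + 4 • msProd T12.val T21.val)
    (hI3 : I3 = 2 • msProd T11.val T22.val)
    (T : Set (ZMod (Monoid.exponent G))ˣ)
    (hT : T = {t | msPow t I1 = I1 ∧ msPow t (I2 - I3) = I2 - I3
        ∧ msPow t (I3 - I2) = I3 - I2})
    (K : IntermediateField ℚ ℂ)
    (hK : K = IntermediateField.adjoin ℚ
      ({z : ℂ | ∃ χ : G → ℂ, IsIrrChar G χ ∧ z = (I1.map χ).sum}
        ∪ {z : ℂ | ∃ χ : G → ℂ, IsIrrChar G χ ∧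
            z = ((I2 - I3).map χ).sum - ((I3 - I2).map χ).sum}))
    (hvals : ∀ χ : G → ℂ, IsIrrChar G χ →
      χ 1 * (((I2 - I3).map χ).sum - ((I3 - I2).map χ).sum) ∈ K)
    (M : Subgroup ((↥K)ˣ ⧸ (powMonoidHom 2 : (↥K)ˣ →* (↥K)ˣ).range))
    (hM : M = Subgroup.closure
      {q | ∃ (χ : G → ℂ) (hχ : IsIrrChar G χ)
          (hne : (⟨χ 1 * (((I2 - I3).map χ).sum - ((I3 - I2).map χ).sum),
                    hvals χ hχ⟩ : ↥K) ≠ 0),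
        q = QuotientGroup.mk (Units.mk0 _ hne)}) :
    (∀ z : ℂ, Polynomial.aeval z (scMatrix T11 T22 T12 T21).charpoly = 0 →
        ∃ n : ℤ, z = (n : ℂ))
      ↔ (T = Set.univ ∧ M = ⊥) := by
  have hd : ∀ χ : G → ℂ, IsIrrChar G χ → ∃ d : ℕ, χ 1 = d ∧ χ 1 ≠ 0 := fun χ hχ => by
    obtain ⟨d, hd, h1, -⟩ := hχ.exists_eigenvector
    exact ⟨d, h1, by rw [h1]; exact_mod_cast hd.ne'⟩
  have hsumI1 : ∀ χ : G → ℂ, (I1.map χ).sum = (T11.val.map χ).sum + (T22.val.map χ).sum := by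
    simp [hI1]
  have hdisc : ∀ χ : G → ℂ, IsIrrChar G χ →
      χ 1 * (((I2 - I3).map χ).sum - ((I3 - I2).map χ).sum) =
        ((T11.val.map χ).sum - (T22.val.map χ).sum) ^ 2 +
          4 * ((T12.val.map χ).sum * (T21.val.map χ).sum) := by
    intro χ hχ
    rw [sum_map_sub_sub_sum_map_sub, hI2, hI3]
    simp only [Multiset.map_add, Multiset.sum_add, Multiset.map_nsmul, Multiset.sum_nsmul,
      nsmul_eq_mul]
    push_cast
    linear_combination hχ.sum_msProd h11 h11 + hχ.sum_msProd h22 h22 +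
      4 * hχ.sum_msProd h12 h21 - 2 * hχ.sum_msProd h11 h22
  have hc1 : ∀ g h : G, I1.count (h⁻¹ * g * h) = I1.count g := by
    refine count_conj_of_commute fun y => ?_
    rw [hI1, multisetSum_add]
    exact (h11.commute y).add_left (h22.commute y)
  have hc2 : ∀ g h : G, I2.count (h⁻¹ * g * h) = I2.count g := by
    refine count_conj_of_commute fun y => ?_
    rw [hI2, multisetSum_add, multisetSum_add, multisetSum_nsmul]
    exact ((h11.commute_msProd h11 y).add_left (h22.commute_msProd h22 y)).add_left
      ((h12.commute_msProd h21 y).smul_left 4)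
  have hc3 : ∀ g h : G, I3.count (h⁻¹ * g * h) = I3.count g := by
    refine count_conj_of_commute fun y => ?_
    rw [hI3, multisetSum_nsmul]
    exact (h11.commute_msProd h22 y).smul_left 2
  have hrat1 := forall_isIrrChar_rat_iff (fun g => (I1.count g : ℤ)) (fun g h => by rw [hc1])
  have hrat2 := forall_isIrrChar_rat_iff (fun g => (I2.count g : ℤ) - I3.count g)
    (fun g h => by rw [hc2, hc3])
  simp only [← sum_map_eq_sum_count] at hrat1
  simp only [Int.cast_sub, sub_mul, Finset.sum_sub_distrib, ← sum_map_eq_sum_count] at hrat2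
  have hTuniv : T = Set.univ ↔
      (∀ χ : G → ℂ, IsIrrChar G χ → ∃ q : ℚ, (I1.map χ).sum = q) ∧
      (∀ χ : G → ℂ, IsIrrChar G χ →
        ∃ q : ℚ, ((I2 - I3).map χ).sum - ((I3 - I2).map χ).sum = q) := by
    simp only [sum_map_sub_sub_sum_map_sub]
    rw [hrat1, hrat2, hT, Set.eq_univ_iff_forall, ← forall_and]
    refine forall_congr' fun t => ?_
    rw [Set.mem_ofPred_eq, msPow_eq_self_iff, msPow_eq_self_iff, msPow_eq_self_iff,
      ← forall_and, ← forall_and, ← forall_and]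
    refine forall_congr' fun g => ?_
    simp only [Multiset.count_sub]
    omega
  have hspec := aeval_charpoly_scMatrix_eq_zero_iff_exists_isIrrChar T11 T22 T12 T21 h11 h22 h12 h21
  constructor
  · intro hint
    have hroots : ∀ χ : G → ℂ, IsIrrChar G χ → ∃ n k : ℤ,
        (I1.map χ).sum = χ 1 * n ∧
        χ 1 * (((I2 - I3).map χ).sum - ((I3 - I2).map χ).sum) = (χ 1 * k) ^ 2 := by
      intro χ hχ
      obtain ⟨-, -, hd'⟩ := hd χ hχ
      obtain ⟨s, hs⟩ := IsAlgClosed.exists_pow_nat_eq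
        (χ 1 * (((I2 - I3).map χ).sum - ((I3 - I2).map χ).sum)) zero_lt_two
      have hroot : ∀ r : ℂ, r ^ 2 = s ^ 2 → ∃ n : ℤ, ((I1.map χ).sum + r) / (2 * χ 1) = n := by
        intro r hr
        refine hint _ ((hspec _).2 ⟨χ, hχ, ?_⟩)
        rw [hs, hdisc χ hχ] at hr
        rw [hsumI1]
        field_simp
        linear_combination hr
      obtain ⟨n, hn⟩ := hroot s rfl
      obtain ⟨k, hk⟩ := hroot (-s) (by ring)
      refine ⟨n + k, n - k, ?_, ?_⟩
      · push_cast
        rw [← hn, ← hk]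
        field_simp
        ring
      · rw [← hs]
        congr 1
        push_cast
        rw [← hn, ← hk]
        field_simp
        ring
    refine ⟨hTuniv.2 ⟨fun χ hχ => ?_, fun χ hχ => ?_⟩, ?_⟩
    · obtain ⟨n, -, hn, -⟩ := hroots χ hχ
      obtain ⟨d, h1, -⟩ := hd χ hχ
      exact ⟨d * n, by rw [hn, h1]; push_cast; ring⟩
    · obtain ⟨-, k, -, hk⟩ := hroots χ hχ
      obtain ⟨d, h1, hd'⟩ := hd χ hχ
      refine ⟨d * k ^ 2, mul_left_cancel₀ hd' ?_⟩
      rw [hk, h1]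
      push_cast
      ring
    · rw [hM, Subgroup.closure_eq_bot_iff]
      rintro q ⟨χ, hχ, hne, rfl⟩
      obtain ⟨-, k, -, hk⟩ := hroots χ hχ
      obtain ⟨d, h1, -⟩ := hd χ hχ
      have hsq : (⟨_, hvals χ hχ⟩ : K) = ((d : K) * k) ^ 2 := by
        apply Subtype.ext
        push_cast
        rw [← h1]
        exact hk
      have hr : (d : K) * k ≠ 0 := fun h0 => hne (by rw [hsq, h0]; ring)
      rw [Set.mem_singleton_iff, QuotientGroup.eq_one_iff]
      exact ⟨Units.mk0 _ hr, Units.ext hsq.symm⟩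
  · rintro ⟨hTu, hMb⟩ z hz
    obtain ⟨hq1, hq2⟩ := hTuniv.1 hTu
    have hKbot : ∀ x ∈ K, ∃ q : ℚ, x = q := by
      have hle : K ≤ ⊥ := by
        rw [hK, IntermediateField.adjoin_le_iff]
        rintro x (⟨χ, hχ, rfl⟩ | ⟨χ, hχ, rfl⟩)
        · obtain ⟨q, hq⟩ := hq1 χ hχ
          exact IntermediateField.mem_bot.2 ⟨q, by simp [hq]⟩
        · obtain ⟨q, hq⟩ := hq2 χ hχ
          exact IntermediateField.mem_bot.2 ⟨q, by simp [hq]⟩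
      intro x hx
      obtain ⟨q, rfl⟩ := IntermediateField.mem_bot.1 (hle hx)
      exact ⟨q, by simp⟩
    obtain ⟨χ, hχ, hχz⟩ := (hspec z).1 hz
    obtain ⟨d, h1, hd'⟩ := hd χ hχ
    obtain ⟨p, hp⟩ := hq1 χ hχ
    obtain ⟨r, hr⟩ : ∃ r : ℚ,
        χ 1 * (((I2 - I3).map χ).sum - ((I3 - I2).map χ).sum) = (r : ℂ) ^ 2 := by
      by_cases hne : (⟨_, hvals χ hχ⟩ : K) = 0
      · exact ⟨0, by simpa using congrArg Subtype.val hne⟩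
      · have hmem : (QuotientGroup.mk (Units.mk0 _ hne) :
            (K)ˣ ⧸ (powMonoidHom 2 : (K)ˣ →* (K)ˣ).range) ∈ M := by
          rw [hM]
          exact Subgroup.subset_closure ⟨χ, hχ, hne, rfl⟩
        rw [hMb, Subgroup.mem_bot, QuotientGroup.eq_one_iff] at hmem
        obtain ⟨w, hw⟩ := hmem
        obtain ⟨r, hr⟩ := hKbot _ (w : K).2
        refine ⟨r, ?_⟩
        rw [← hr]
        exact (congrArg (fun v : (K)ˣ => ((v : K) : ℂ)) hw).symm
    rw [hdisc χ hχ] at hr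
    rw [hsumI1] at hp
    field_simp at hχz
    have hsq : (2 * (χ 1 * z) - p) ^ 2 = (r : ℂ) ^ 2 := by
      rw [← hr, ← hp]
      linear_combination 4 * hχz
    have hint := isIntegral_of_aeval_charpoly_scMatrix hz
    rcases sq_eq_sq_iff_eq_or_eq_neg.1 hsq with h | h
    · refine exists_int_of_isIntegral_of_rat hint (q := (p + r) / (2 * d)) ?_
      push_cast
      rw [← h1]
      field_simp
      linear_combination h
    · refine exists_int_of_isIntegral_of_rat hint (q := (p - r) / (2 * d)) ?_
      push_cast
      rw [← h1]
      field_simp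
      linear_combination h
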